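/- arXiv:2311.10212 — 8 statements merged into one kernel-verified Lean document; each statement's English description precedes it below -/
import Mathlib

section
/- For all rational numbers s > 0 and t ≥ 0, the matrix M = s·N1 + t·N2 is nilpotent of Jordan type one 4-block plus one 2-block: M^4 = 0, M^3 ≠ 0, rank M = 4, rank M^2 = 2, and rank M^3 = 1. (This is the Jordan-type computation showing that every element of the nilpotent cone at the maximal unipotent monodromy point, including its boundary ray through N1, induces a limiting mixed Hodge structure of type IV_2.) -/
open Matrix

/-- The standard symplectic form `Q` on `ℚ^6`. -/
def Q6 : Matrix (Fin 6) (Fin 6) ℚ :=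
  !![0,0,0,1,0,0;
     0,0,0,0,1,0;
     0,0,0,0,0,1;
     -1,0,0,0,0,0;
     0,-1,0,0,0,0;
     0,0,-1,0,0,0]

/-- `H ∈ Sp(6,ℤ)`: an integer matrix satisfying `Hᵀ·Q·H = Q`. -/
def Sp6Z (H : Matrix (Fin 6) (Fin 6) ℤ) : Prop :=
  (H.map (Int.cast : ℤ → ℚ))ᵀ * Q6 * (H.map (Int.cast : ℤ → ℚ)) = Q6

/-- The principal congruence subgroup `Γₙ ⊆ Sp(6,ℤ)`. -/
def GammaN (n : ℕ) (H : Matrix (Fin 6) (Fin 6) ℤ) : Prop :=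
  Sp6Z H ∧ ∀ i j, (n : ℤ) ∣ (H - 1) i j

def Tm1 : Matrix (Fin 6) (Fin 6) ℤ :=
  !![1,1,0,6,-4,-4;
     0,1,0,4,-8,-4;
     0,0,1,0,-4,0;
     0,0,0,1,0,0;
     0,0,0,-1,1,0;
     0,0,0,0,0,1]

def Tm2 : Matrix (Fin 6) (Fin 6) ℤ :=
  !![1,0,1,2,-2,0;
     0,1,0,-2,-4,0;
     0,0,1,0,0,0;
     0,0,0,1,0,0;
     0,0,0,0,1,0;
     0,0,0,-1,0,1]

def TC1sq : Matrix (Fin 6) (Fin 6) ℤ :=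
  !![1,0,0,0,0,0;
     0,1,0,0,0,0;
     0,0,1,0,0,4;
     0,0,0,1,0,0;
     0,0,0,0,1,0;
     0,0,0,0,0,1]

def Tcon1 : Matrix (Fin 6) (Fin 6) ℤ :=
  !![3,0,0,4,0,0;
     0,1,0,0,0,0;
     0,0,1,0,0,0;
     -1,0,0,-1,0,0;
     0,0,0,0,1,0;
     0,0,0,0,0,1]

def TE2sq : Matrix (Fin 6) (Fin 6) ℤ :=
  !![1,0,0,0,0,0;
     0,1,4,0,-24,0;
     0,0,1,0,0,0;
     0,0,0,1,0,0;
     0,0,0,0,1,0;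
     0,0,2,0,-4,1]

def TE0q : Matrix (Fin 6) (Fin 6) ℤ :=
  !![1,0,0,0,0,0;
     0,1,0,0,0,0;
     8,-4,1,0,0,8;
     -8,4,0,1,0,-8;
     4,-2,0,0,1,4;
     0,0,0,0,0,1]

def Tcon2 : Matrix (Fin 6) (Fin 6) ℤ :=
  !![1,0,0,0,0,0;
     -2,3,-2,0,4,0;
     0,0,1,0,0,0;
     -1,1,-1,1,2,0;
     1,-1,1,0,-1,0;
     -1,1,-1,0,2,1]

def TC0 : Matrix (Fin 6) (Fin 6) ℤ :=
  !![-1,-1,2,-2,8,-4;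
     2,3,-2,-8,4,12;
     0,0,1,0,4,0;
     0,0,1,-3,6,0;
     0,0,0,-1,1,0;
     -1,-1,1,2,2,-3]

/-- The monodromy matrix around the exceptional divisor `D_{(1,-1)}`. -/
def Td11 : Matrix (Fin 6) (Fin 6) ℤ :=
  !![1,0,-1,2,-2,0;
     0,1,0,2,-4,4;
     0,1,-1,-4,-8,-2;
     0,0,0,1,0,0;
     0,0,0,1,1,1;
     0,0,0,-1,0,-1]

/-- The monodromy matrix around the divisor `D_{(1,0)}`. -/
def Sd10 : Matrix (Fin 6) (Fin 6) ℤ :=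
  !![1,-1,0,6,4,0;
     0,1,0,-4,-8,-4;
     0,0,1,-4,-4,0;
     0,0,0,1,0,0;
     0,0,0,1,1,0;
     0,0,0,0,0,1]

def N1 : Matrix (Fin 6) (Fin 6) ℚ :=
  !![0,1,0,14/3,0,-2;
     0,0,0,0,-8,-4;
     0,0,0,-2,-4,0;
     0,0,0,0,0,0;
     0,0,0,-1,0,0;
     0,0,0,0,0,0]

def N2 : Matrix (Fin 6) (Fin 6) ℚ :=
  !![0,0,1,2,-2,0;
     0,0,0,-2,-4,0;
     0,0,0,0,0,0;
     0,0,0,0,0,0;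
     0,0,0,0,0,0;
     0,0,0,-1,0,0]

def N3 : Matrix (Fin 6) (Fin 6) ℚ :=
  !![0,0,0,0,0,0;
     0,0,0,0,0,0;
     0,0,0,0,0,4;
     0,0,0,0,0,0;
     0,0,0,0,0,0;
     0,0,0,0,0,0]

def N4 : Matrix (Fin 6) (Fin 6) ℚ :=
  !![2,0,0,4,0,0;
     0,0,0,0,0,0;
     0,0,0,0,0,0;
     -1,0,0,-2,0,0;
     0,0,0,0,0,0;
     0,0,0,0,0,0]

def N5 : Matrix (Fin 6) (Fin 6) ℚ :=
  !![0,0,0,0,0,0;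
     0,0,4,0,-24,0;
     0,0,0,0,0,0;
     0,0,0,0,0,0;
     0,0,0,0,0,0;
     0,0,2,0,-4,0]

def N6 : Matrix (Fin 6) (Fin 6) ℚ :=
  !![0,0,0,0,0,0;
     0,0,0,0,0,0;
     8,-4,0,0,0,8;
     -8,4,0,0,0,-8;
     4,-2,0,0,0,4;
     0,0,0,0,0,0]

def N7 : Matrix (Fin 6) (Fin 6) ℚ :=
  !![0,0,0,0,0,0;
     -2,2,-2,0,4,0;
     0,0,0,0,0,0;
     -1,1,-1,0,2,0;
     1,-1,1,0,-2,0;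
     -1,1,-1,0,2,0]

def E14 : Matrix (Fin 6) (Fin 6) ℚ :=
  !![0,0,0,1,0,0;
     0,0,0,0,0,0;
     0,0,0,0,0,0;
     0,0,0,0,0,0;
     0,0,0,0,0,0;
     0,0,0,0,0,0]

def E25 : Matrix (Fin 6) (Fin 6) ℚ :=
  !![0,0,0,0,0,0;
     0,0,0,0,1,0;
     0,0,0,0,0,0;
     0,0,0,0,0,0;
     0,0,0,0,0,0;
     0,0,0,0,0,0]

def G34 : Matrix (Fin 6) (Fin 6) ℤ :=
  !![1,0,0,1,0,0;
     0,0,1,0,0,0;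
     0,1,0,0,0,0;
     1,0,0,2,0,0;
     0,0,0,0,0,1;
     0,0,0,0,1,0]

def G63 : Matrix (Fin 6) (Fin 6) ℤ :=
  !![0,0,1,0,-2,0;
     0,0,0,0,1,0;
     1,0,0,0,0,0;
     0,0,0,0,0,1;
     2,-1,0,0,0,2;
     0,0,0,1,2,0]

def G67 : Matrix (Fin 6) (Fin 6) ℤ :=
  !![0,0,0,1,1,0;
     0,0,0,1,2,0;
     0,0,1,2,2,0;
     -2,1,0,0,0,-2;
     1,-1,1,0,-2,0;
     0,0,0,1,2,1]

/-- A matrix which factors through `Fin r → K` and has a nonzero `r × r` minor has rank `r`. -/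
theorem rank_eq_of_eq_mul_of_det_submatrix_ne_zero {K m n : Type*} [Field K] [Fintype n] {r : ℕ}
    {M : Matrix m n K} (A : Matrix m (Fin r) K) (B : Matrix (Fin r) n K) (hM : M = A * B)
    (f : Fin r → m) (g : Fin r → n) (hdet : (M.submatrix f g).det ≠ 0) : M.rank = r := by
  apply le_antisymm
  · rw [hM]
    exact (rank_mul_le_left A B).trans (by simpa using rank_le_card_width A)
  · simpa [rank_of_det_ne_zero hdet] using rank_submatrix_le M f g

theorem smul_N1_add_smul_N2 (s t : ℚ) :
    s • N1 + t • N2 =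
      !![0, s, t, 14 / 3 * s + 2 * t, -2 * t, -2 * s;
         0, 0, 0, -2 * t, -8 * s - 4 * t, -4 * s;
         0, 0, 0, -2 * s, -4 * s, 0;
         0, 0, 0, 0, 0, 0;
         0, 0, 0, -s, 0, 0;
         0, 0, 0, -t, 0, 0] := by
  ext i j
  fin_cases i <;> fin_cases j <;> simp [N1, N2] <;> ring

theorem smul_N1_add_smul_N2_sq (s t : ℚ) :
    (s • N1 + t • N2) ^ 2 =
      !![0, 0, 0, 0, -8 * s * (s + t), -4 * s ^ 2;
         0, 0, 0, 8 * s * (s + t), 0, 0;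
         0, 0, 0, 4 * s ^ 2, 0, 0;
         0, 0, 0, 0, 0, 0;
         0, 0, 0, 0, 0, 0;
         0, 0, 0, 0, 0, 0] := by
  rw [sq, smul_N1_add_smul_N2]
  ext i j
  fin_cases i <;> fin_cases j <;> simp [Matrix.mul_apply, Fin.sum_univ_succ] <;> ring

theorem smul_N1_add_smul_N2_cube (s t : ℚ) :
    (s • N1 + t • N2) ^ 3 =
      Matrix.single 0 3 (8 * s ^ 3 + 12 * s ^ 2 * t) := by
  rw [pow_succ, smul_N1_add_smul_N2_sq, smul_N1_add_smul_N2]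
  ext i j
  fin_cases i <;> fin_cases j <;> simp [Matrix.mul_apply, Fin.sum_univ_succ]
  ring

/-- Every element `s·N1 + t·N2` (`s > 0`, `t ≥ 0`) of the nilpotent cone at the MUM
point has Jordan type one 4-block plus one 2-block (LMHS type `IV₂`). -/
theorem stmt7 (s t : ℚ) (hs : 0 < s) (ht : 0 ≤ t) :
    (s • N1 + t • N2) ^ 4 = 0 ∧ (s • N1 + t • N2) ^ 3 ≠ 0 ∧
    (s • N1 + t • N2).rank = 4 ∧
    ((s • N1 + t • N2) ^ 2).rank = 2 ∧
    ((s • N1 + t • N2) ^ 3).rank = 1 := by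
  have hc : 8 * s ^ 3 + 12 * s ^ 2 * t ≠ 0 := by positivity
  have hcube := smul_N1_add_smul_N2_cube s t
  refine ⟨?_, ?_, ?_, ?_, ?_⟩
  · rw [pow_succ, hcube, smul_N1_add_smul_N2]
    ext i j
    fin_cases i <;> fin_cases j <;>
      simp [Matrix.mul_apply, Matrix.single_apply]
  · intro h
    rw [hcube] at h
    exact hc (by simpa using congrFun (congrFun h 0) 3)
  · rw [smul_N1_add_smul_N2]
    refine rank_eq_of_eq_mul_of_det_submatrix_ne_zero
      !![1, 0, 0, 0; 0, 1, 0, 0; 0, 0, 1, 0; 0, 0, 0, 0; 0, 0, 0, -s; 0, 0, 0, -t]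
      !![0, s, t, 14 / 3 * s + 2 * t, -2 * t, -2 * s;
         0, 0, 0, -2 * t, -8 * s - 4 * t, -4 * s;
         0, 0, 0, -2 * s, -4 * s, 0;
         0, 0, 0, 1, 0, 0] ?_ ![0, 1, 2, 4] ![1, 5, 4, 3] ?_
    · ext i j
      fin_cases i <;> fin_cases j <;> simp [Matrix.mul_apply, Fin.sum_univ_succ]
    · rw [det_succ_column_zero, Fin.sum_univ_four]
      simp [-submatrix_submatrix, -submatrix_cons_row, det_fin_three, Fin.succAbove, hs.ne']
  · rw [smul_N1_add_smul_N2_sq]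
    refine rank_eq_of_eq_mul_of_det_submatrix_ne_zero
      !![1, 0; 0, 8 * s * (s + t); 0, 4 * s ^ 2; 0, 0; 0, 0; 0, 0]
      !![0, 0, 0, 0, -8 * s * (s + t), -4 * s ^ 2; 0, 0, 0, 1, 0, 0] ?_ ![0, 2] ![5, 3] ?_
    · ext i j
      fin_cases i <;> fin_cases j <;> simp [Matrix.mul_apply, Fin.sum_univ_succ]
    · rw [det_fin_two]
      simp only [submatrix_apply]
      simp [hs.ne']
  · rw [hcube]
    refine rank_eq_of_eq_mul_of_det_submatrix_ne_zero
      (Matrix.single 0 0 (8 * s ^ 3 + 12 * s ^ 2 * t)) (Matrix.single 0 3 1) ?_ ![0] ![3] ?_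
    · simp
    · rw [det_fin_one]
      simpa only [submatrix_apply, cons_val_zero, single_apply_same] using hc
end

section
/- For all rational numbers s > 0 and t > 0, the matrix M = s·N1 + t·N3 is nilpotent of Jordan type one 4-block plus one 2-block: M^4 = 0, M^3 ≠ 0, rank M = 4, rank M^2 = 2, and rank M^3 = 1. (This is the Jordan-type computation showing that the interior of the nilpotent cone σ13 induces limiting mixed Hodge structures of type IV_2.) -/
open Matrix

/-- A matrix that factors through an index type of cardinality `k` and has an invertible
square submatrix of size `k` has rank `k`. -/
theorem rank_eq_card_of_eq_mul_of_det_submatrix_ne_zero {K m n r : Type*} [Field K]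
    [Fintype m] [Fintype n] [Fintype r] [DecidableEq r]
    {A : Matrix m n K} (B : Matrix m r K) (C : Matrix r n K) (hA : A = B * C)
    (f : r → m) (g : r → n) (hdet : (A.submatrix f g).det ≠ 0) :
    A.rank = Fintype.card r := by
  apply le_antisymm
  · rw [hA]
    exact (rank_mul_le_left B C).trans (rank_le_card_width B)
  · rw [← rank_of_isUnit _ ((isUnit_iff_isUnit_det _).2 hdet.isUnit)]
    exact rank_submatrix_le _ _ _

theorem smul_N1_add_smul_N3 (s t : ℚ) :
    s • N1 + t • N3 =
      !![0,s,0,14/3*s,0,-2*s;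
         0,0,0,0,-8*s,-4*s;
         0,0,0,-2*s,-4*s,4*t;
         0,0,0,0,0,0;
         0,0,0,-s,0,0;
         0,0,0,0,0,0] := by
  ext i j
  fin_cases i <;> fin_cases j <;> simp [N1, N3, mul_comm]

theorem smul_N1_add_smul_N3_sq (s t : ℚ) :
    (s • N1 + t • N3) ^ 2 =
      !![0,0,0,0,-8*s^2,-4*s^2;
         0,0,0,8*s^2,0,0;
         0,0,0,4*s^2,0,0;
         0,0,0,0,0,0;
         0,0,0,0,0,0;
         0,0,0,0,0,0] := by
  rw [pow_two, smul_N1_add_smul_N3]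
  ext i j
  fin_cases i <;> fin_cases j <;> simp [mul_apply, Fin.sum_univ_succ] <;> ring

theorem smul_N1_add_smul_N3_cube (s t : ℚ) :
    (s • N1 + t • N3) ^ 3 = (8 * s ^ 3) • E14 := by
  rw [pow_succ, smul_N1_add_smul_N3_sq, smul_N1_add_smul_N3]
  ext i j
  fin_cases i <;> fin_cases j <;> simp [mul_apply, Fin.sum_univ_succ, E14]
  ring

theorem smul_N1_add_smul_N3_pow_four (s t : ℚ) : (s • N1 + t • N3) ^ 4 = 0 := by
  rw [pow_succ, smul_N1_add_smul_N3_cube, smul_N1_add_smul_N3]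
  ext i j
  fin_cases i <;> fin_cases j <;> simp [mul_apply, Fin.sum_univ_succ, E14]

theorem rank_smul_N1_add_smul_N3 {s t : ℚ} (hs : 0 < s) (ht : 0 < t) :
    (s • N1 + t • N3).rank = 4 := by
  rw [smul_N1_add_smul_N3]
  refine rank_eq_card_of_eq_mul_of_det_submatrix_ne_zero (r := Fin 4)
    !![1,0,0,0; 0,1,0,0; 0,0,1,0; 0,0,0,0; 0,0,0,1; 0,0,0,0]
    !![0,s,0,14/3*s,0,-2*s; 0,0,0,0,-8*s,-4*s; 0,0,0,-2*s,-4*s,4*t; 0,0,0,-s,0,0]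
    ?_ ![0,1,2,4] ![1,3,4,5] ?_
  · ext i j
    fin_cases i <;> fin_cases j <;> simp [mul_apply, Fin.sum_univ_succ]
  · have h : 0 < s ^ 3 * (32 * t + 16 * s) := by positivity
    refine ne_of_eq_of_ne ?_ h.ne'
    rw [det_succ_row_zero]
    simp only [Fin.sum_univ_four, det_fin_three, submatrix_apply]
    simp [Fin.succAbove]
    ring

theorem rank_smul_N1_add_smul_N3_sq {s : ℚ} (t : ℚ) (hs : 0 < s) :
    ((s • N1 + t • N3) ^ 2).rank = 2 := by
  rw [smul_N1_add_smul_N3_sq]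
  refine rank_eq_card_of_eq_mul_of_det_submatrix_ne_zero (r := Fin 2)
    !![1,0; 0,2; 0,1; 0,0; 0,0; 0,0]
    !![0,0,0,0,-8*s^2,-4*s^2; 0,0,0,4*s^2,0,0]
    ?_ ![0,1] ![4,3] ?_
  · ext i j
    fin_cases i <;> fin_cases j <;> simp [mul_apply, Fin.sum_univ_succ]
    ring
  · rw [det_fin_two]
    simp [hs.ne']

theorem rank_smul_E14 {c : ℚ} (hc : c ≠ 0) : (c • E14).rank = 1 := by
  refine rank_eq_card_of_eq_mul_of_det_submatrix_ne_zero (r := Fin 1)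
    !![1; 0; 0; 0; 0; 0] !![0,0,0,c,0,0] ?_ ![0] ![3] ?_
  · ext i j
    fin_cases i <;> fin_cases j <;> simp [mul_apply, E14]
  · rw [det_fin_one]
    simpa [E14] using hc

/-- Every element `s·N1 + t·N3` (`s, t > 0`) of the interior of the nilpotent cone
`σ₁₃` has Jordan type one 4-block plus one 2-block (LMHS type `IV₂`). -/
theorem stmt8 (s t : ℚ) (hs : 0 < s) (ht : 0 < t) :
    (s • N1 + t • N3) ^ 4 = 0 ∧ (s • N1 + t • N3) ^ 3 ≠ 0 ∧
    (s • N1 + t • N3).rank = 4 ∧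
    ((s • N1 + t • N3) ^ 2).rank = 2 ∧
    ((s • N1 + t • N3) ^ 3).rank = 1 := by
  have hc : 8 * s ^ 3 ≠ 0 := by positivity
  have hrank : ((s • N1 + t • N3) ^ 3).rank = 1 := by
    rw [smul_N1_add_smul_N3_cube, rank_smul_E14 hc]
  refine ⟨smul_N1_add_smul_N3_pow_four s t, fun h => ?_, rank_smul_N1_add_smul_N3 hs ht,
    rank_smul_N1_add_smul_N3_sq t hs, hrank⟩
  simp [h] at hrank
end

section
/- For all rational numbers s > 0 and t > 0, each of the matrices s·N3 + t·N4, s·N6 + t·N3 and s·N6 + t·N7 squares to zero and has rank 2. (This is the Jordan-type computation showing that the interiors of the nilpotent cones σ34, σ63 and σ67 induce limiting mixed Hodge structures of type I_2.) -/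
open Matrix

theorem smul_vecMulVec_add_sq_eq_zero {n R : Type*} [Fintype n] [DecidableEq n] [CommRing R]
    {a b c d : n → R} (hba : b ⬝ᵥ a = 0) (hbc : b ⬝ᵥ c = 0) (hda : d ⬝ᵥ a = 0)
    (hdc : d ⬝ᵥ c = 0) (s t : R) :
    (s • vecMulVec a b + t • vecMulVec c d) ^ 2 = 0 := by
  simp [sq, add_mul, mul_add, vecMulVec_mul_vecMulVec, hba, hbc, hda, hdc]

theorem rank_smul_vecMulVec_add_eq_two {n K : Type*} [Fintype n] [Field K]
    {a b c d : n → K} {s t : K} (hs : s ≠ 0) (ht : t ≠ 0) {i i' j j' : n}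
    (hac : a i * c i' - c i * a i' ≠ 0) (hbd : b j * d j' - b j' * d j ≠ 0) :
    (s • vecMulVec a b + t • vecMulVec c d).rank = 2 := by
  apply le_antisymm
  · have h : s • vecMulVec a b + t • vecMulVec c d =
        (of ![s • a, t • c])ᵀ * of ![b, d] := by
      ext k l
      simp [mul_apply, Fin.sum_univ_two, vecMulVec_apply, mul_assoc]
    rw [h]
    exact (rank_mul_le_left _ _).trans (rank_le_card_width _)
  · have hdet : ((s • vecMulVec a b + t • vecMulVec c d).submatrix ![i, i'] ![j, j']).det ≠ 0 := by
      have h : ((s • vecMulVec a b + t • vecMulVec c d).submatrix ![i, i'] ![j, j']).det =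
          s * t * (a i * c i' - c i * a i') * (b j * d j' - b j' * d j) := by
        rw [det_fin_two]
        simp [vecMulVec_apply]
        ring
      rw [h]
      exact mul_ne_zero (mul_ne_zero (mul_ne_zero hs ht) hac) hbd
    have hrank := rank_of_isUnit _ ((isUnit_iff_isUnit_det _).mpr hdet.isUnit)
    rw [Fintype.card_fin] at hrank
    exact hrank.symm.le.trans (rank_submatrix_le _ _ _)

theorem N3_eq_vecMulVec : N3 = vecMulVec ![0, 0, 1, 0, 0, 0] ![0, 0, 0, 0, 0, 4] := by
  ext i j
  fin_cases i <;> fin_cases j <;> norm_num [N3, vecMulVec_apply]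

theorem N4_eq_vecMulVec : N4 = vecMulVec ![2, 0, 0, -1, 0, 0] ![1, 0, 0, 2, 0, 0] := by
  ext i j
  fin_cases i <;> fin_cases j <;> norm_num [N4, vecMulVec_apply]

theorem N6_eq_vecMulVec : N6 = vecMulVec ![0, 0, 2, -2, 1, 0] ![4, -2, 0, 0, 0, 4] := by
  ext i j
  fin_cases i <;> fin_cases j <;> norm_num [N6, vecMulVec_apply]

theorem N7_eq_vecMulVec : N7 = vecMulVec ![0, -2, 0, -1, 1, -1] ![1, -1, 1, 0, -2, 0] := by
  ext i j
  fin_cases i <;> fin_cases j <;> norm_num [N7, vecMulVec_apply]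

/-- The interiors of the nilpotent cones `σ₃₄`, `σ₆₃` and `σ₆₇` consist of matrices
squaring to zero of rank 2 (LMHS type `I₂`). -/
theorem stmt10 (s t : ℚ) (hs : 0 < s) (ht : 0 < t) :
    ((s • N3 + t • N4) ^ 2 = 0 ∧ (s • N3 + t • N4).rank = 2) ∧
    ((s • N6 + t • N3) ^ 2 = 0 ∧ (s • N6 + t • N3).rank = 2) ∧
    ((s • N6 + t • N7) ^ 2 = 0 ∧ (s • N6 + t • N7).rank = 2) := by
  rw [N3_eq_vecMulVec, N4_eq_vecMulVec, N6_eq_vecMulVec, N7_eq_vecMulVec]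
  refine ⟨⟨smul_vecMulVec_add_sq_eq_zero ?_ ?_ ?_ ?_ s t,
      rank_smul_vecMulVec_add_eq_two hs.ne' ht.ne' (i := 2) (i' := 0) (j := 5) (j' := 0) ?_ ?_⟩,
    ⟨smul_vecMulVec_add_sq_eq_zero ?_ ?_ ?_ ?_ s t,
      rank_smul_vecMulVec_add_eq_two hs.ne' ht.ne' (i := 3) (i' := 2) (j := 0) (j' := 5) ?_ ?_⟩,
    ⟨smul_vecMulVec_add_sq_eq_zero ?_ ?_ ?_ ?_ s t,
      rank_smul_vecMulVec_add_eq_two hs.ne' ht.ne' (i := 2) (i' := 1) (j := 0) (j' := 2) ?_ ?_⟩⟩ <;>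
  (simp [dotProduct, Fin.sum_univ_six] <;> norm_num)
end

section
/- For all rational numbers s > 0 and t > 0, each of the matrices s·N4 + t·N5 and s·N5 + t·N2 squares to zero and has rank 3. (This is the Jordan-type computation showing that the interiors of the nilpotent cones σ45 and σ52 induce limiting mixed Hodge structures of type II_1.) -/
open Matrix

/-- A `6 × 6` matrix squaring to zero and having a nonzero `3 × 3` minor has rank 3. -/
theorem rank_eq_three_of_sq_eq_zero {K : Type*} [Field K] {A : Matrix (Fin 6) (Fin 6) K}
    (hA : A ^ 2 = 0) (r c : Fin 3 → Fin 6) (hdet : (A.submatrix r c).det ≠ 0) :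
    A.rank = 3 := by
  have upper := rank_add_rank_le_card_of_mul_eq_zero (sq A ▸ hA)
  have lower := A.rank_submatrix_le r c
  rw [rank_of_isUnit _ ((isUnit_iff_isUnit_det _).2 hdet.isUnit)] at lower
  simp only [Fintype.card_fin] at upper lower
  omega

/-- The interiors of the nilpotent cones `σ₄₅` and `σ₅₂` consist of matrices squaring
to zero of rank 3 (LMHS type `II₁`). -/
theorem stmt11 (s t : ℚ) (hs : 0 < s) (ht : 0 < t) :
    ((s • N4 + t • N5) ^ 2 = 0 ∧ (s • N4 + t • N5).rank = 3) ∧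
    ((s • N5 + t • N2) ^ 2 = 0 ∧ (s • N5 + t • N2).rank = 3) := by
  have h45 : (s • N4 + t • N5) ^ 2 = 0 := by
    ext i j
    fin_cases i <;> fin_cases j <;>
      simp [N4, N5, sq, mul_apply, Fin.sum_univ_succ] <;> ring
  have h52 : (s • N5 + t • N2) ^ 2 = 0 := by
    ext i j
    fin_cases i <;> fin_cases j <;>
      simp [N5, N2, sq, mul_apply, Fin.sum_univ_succ]
  refine ⟨⟨h45, rank_eq_three_of_sq_eq_zero h45 ![0, 1, 5] ![0, 2, 4] ?_⟩,
    ⟨h52, rank_eq_three_of_sq_eq_zero h52 ![0, 1, 5] ![2, 3, 4] ?_⟩⟩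
  · have hdet : ((s • N4 + t • N5).submatrix ![0, 1, 5] ![0, 2, 4]).det = 64 * s * t ^ 2 := by
      rw [det_fin_three]
      simp [N4, N5]
      ring
    rw [hdet]
    positivity
  · have hdet : ((s • N5 + t • N2).submatrix ![0, 1, 5] ![2, 3, 4]).det =
        -(4 * t * (4 * s + t) ^ 2) := by
      rw [det_fin_three]
      simp [N5, N2]
      ring
    rw [hdet, neg_ne_zero]
    positivity
end

section
/- Let H be a matrix in Γ₃ and let s1, t1, s2, t2 be rational numbers with s1 > 0, t1 > 0, s2 > 0 and t2 ≥ 0. If H·(s1·N1 + t1·N2) = (s2·N1 + t2·N2)·H, then s1 = s2 and t1 = t2. (This is the statement that the Ad(Γ₃)-orbit of the nilpotent cone σ12 at the maximal unipotent monodromy point has no non-trivial interior intersection with σ12.) -/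
open Matrix

/-- The square of a combination of `N1` and `N2`. -/
theorem cone_sq (s t : ℚ) :
    (s • N1 + t • N2) * (s • N1 + t • N2) =
      !![0,0,0,0,-8 * s ^ 2 - 8 * s * t,-4 * s ^ 2;
         0,0,0,8 * s ^ 2 + 8 * s * t,0,0;
         0,0,0,4 * s ^ 2,0,0;
         0,0,0,0,0,0;
         0,0,0,0,0,0;
         0,0,0,0,0,0] := by
  simp only [N1, N2, Matrix.smul_of, Matrix.smul_cons, Matrix.smul_empty, smul_eq_mul]
  ext i j
  rw [Matrix.mul_apply, Fin.sum_univ_six]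
  fin_cases i <;> fin_cases j <;> simp <;> ring

/-- The cube of a combination of `N1` and `N2` is supported in one corner entry. -/
theorem cone_cube (s t : ℚ) :
    (s • N1 + t • N2) ^ 3 = (4 * (2 * s ^ 3 + 3 * s ^ 2 * t)) • E14 := by
  rw [pow_succ, pow_two, cone_sq]
  ext i j
  rw [Matrix.mul_apply, Fin.sum_univ_six]
  fin_cases i <;> fin_cases j <;> simp [N1, N2, E14] <;> ring

theorem int_eq_and_sq_eq_one_of_mul_eq_one {a b : ℤ} (h : a * b = 1) : a = b ∧ a ^ 2 = 1 := by
  rcases Int.mul_eq_one_iff_eq_one_or_neg_one.1 h with ⟨rfl, rfl⟩ | ⟨rfl, rfl⟩ <;> norm_num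

/-- The `Ad(Γ₃)`-orbit of the nilpotent cone `σ₁₂` has no non-trivial interior
intersection with `σ₁₂`. -/
theorem stmt12 (H : Matrix (Fin 6) (Fin 6) ℤ) (hH : GammaN 3 H)
    (s1 t1 s2 t2 : ℚ) (hs1 : 0 < s1) (ht1 : 0 < t1) (hs2 : 0 < s2) (ht2 : 0 ≤ t2)
    (h : (H.map (Int.cast : ℤ → ℚ)) * (s1 • N1 + t1 • N2)
        = (s2 • N1 + t2 • N2) * (H.map (Int.cast : ℤ → ℚ))) :
    s1 = s2 ∧ t1 = t2 := by
  obtain ⟨hQ, -⟩ := hH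
  have h3 : (H.map (Int.cast : ℤ → ℚ)) * (s1 • N1 + t1 • N2) ^ 3
      = (s2 • N1 + t2 • N2) ^ 3 * (H.map (Int.cast : ℤ → ℚ)) :=
    SemiconjBy.pow_right (show SemiconjBy _ _ _ from h) 3
  rw [cone_cube, cone_cube] at h3
  have hc1 : 2 * s1 ^ 3 + 3 * s1 ^ 2 * t1 ≠ 0 := by positivity
  have hc2 : 2 * s2 ^ 3 + 3 * s2 ^ 2 * t2 ≠ 0 := by positivity
  have entry (i j) := congrFun (congrFun h i) j
  have pairing (i j) := congrFun (congrFun hQ i) j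
  have cube (i j) := congrFun (congrFun h3 i) j
  simp only [Matrix.mul_apply, Fin.sum_univ_six] at entry pairing cube
  have h10 : H 1 0 = 0 := by simpa [E14, hc1] using cube 1 3
  have h20 : H 2 0 = 0 := by simpa [E14, hc1] using cube 2 3
  have h30 : H 3 0 = 0 := by simpa [E14, hc1] using cube 3 3
  have h40 : H 4 0 = 0 := by simpa [E14, hc1] using cube 4 3
  have h50 : H 5 0 = 0 := by simpa [E14, hc1] using cube 5 3
  have h31 : H 3 1 = 0 := by simpa [E14, hc2] using cube 0 1
  have h32 : H 3 2 = 0 := by simpa [E14, hc2] using cube 0 2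
  have h34 : H 3 4 = 0 := by simpa [E14, hc2] using cube 0 4
  have h35 : H 3 5 = 0 := by simpa [E14, hc2] using cube 0 5
  have corner : (H 0 0 : ℚ) * (4 * (2 * s1 ^ 3 + 3 * s1 ^ 2 * t1))
      = 4 * (2 * s2 ^ 3 + 3 * s2 ^ 2 * t2) * H 3 3 := by simpa [E14] using cube 0 3
  have h41 : H 4 1 = 0 := by simpa [N1, N2, *, hs2.ne'] using entry 2 1
  have h42 : H 4 2 = 0 := by simpa [N1, N2, *, hs2.ne'] using entry 2 2
  have h51 : H 5 1 = 0 := by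
    simpa [N1, N2, h31, h41, h10, h20, hs2.ne'] using entry 1 1
  have h52 : H 5 2 = 0 := by
    simpa [N1, N2, h32, h42, h10, h20, hs2.ne'] using entry 1 2
  have e14 := entry 1 4
  have e15 := entry 1 5
  have e24 := entry 2 4
  have e25 := entry 2 5
  simp [N1, N2, h10, h20, h34, h35] at e14 e15 e24 e25
  have q03 := pairing 0 3
  have q14 := pairing 1 4
  have q15 := pairing 1 5
  have q25 := pairing 2 5
  simp [Q6, h10, h20, h30, h40, h50, h31, h32, h41, h42, h51, h52, h34, h35]
    at q03 q14 q15 q25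
  obtain ⟨hends, hend⟩ := int_eq_and_sq_eq_one_of_mul_eq_one
    (show H 0 0 * H 3 3 = 1 by exact_mod_cast q03)
  obtain ⟨hdets, hdet⟩ := int_eq_and_sq_eq_one_of_mul_eq_one
    (show (H 1 1 * H 2 2 - H 1 2 * H 2 1) * (H 4 4 * H 5 5 - H 4 5 * H 5 4) = 1 by
      have : (((H 1 1 * H 2 2 - H 1 2 * H 2 1) * (H 4 4 * H 5 5 - H 4 5 * H 5 4) : ℤ) : ℚ)
          = 1 := by
        push_cast
        linear_combination (H 1 2 * H 4 5 + H 2 2 * H 5 5 : ℚ) * q14 + q25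
          - (H 1 2 * H 4 4 + H 2 2 * H 5 4 : ℚ) * q15
      exact_mod_cast this)
  have hforms : ((H 1 1 * H 2 2 - H 1 2 * H 2 1 : ℤ) : ℚ) * s1 ^ 2
      = s2 ^ 2 * ((H 4 4 * H 5 5 - H 4 5 * H 5 4 : ℤ) : ℚ) := by
    push_cast
    linear_combination (1 / 4 * (H 2 1 * s1) : ℚ) * e14
      + (1 / 16 * ((-(s2 * 8) + -(t2 * 4)) * H 4 4 + -(s2 * 4 * H 5 4)) : ℚ) * e25
      + (1 / 16 * (H 2 1 * (-(s1 * 8) + -(t1 * 4)) + -(H 2 2 * (s1 * 4))) : ℚ) * e15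
      + (1 / 16 * ((-(s2 * 8) + -(t2 * 4)) * H 4 5 + -(s2 * 4 * H 5 5)) : ℚ) * e24
  have hdet0 : ((H 4 4 * H 5 5 - H 4 5 * H 5 4 : ℤ) : ℚ) ≠ 0 := by
    rw [← hdets]
    intro h0
    rw [Int.cast_eq_zero] at h0
    simp [h0] at hdet
  have hend0 : (H 3 3 : ℚ) ≠ 0 := by
    rw [← hends]
    intro h0
    rw [Int.cast_eq_zero] at h0
    simp [h0] at hend
  have hs : s1 = s2 := by
    rw [hdets, mul_comm] at hforms
    exact (pow_left_inj₀ hs1.le hs2.le two_ne_zero).1 (mul_right_cancel₀ hdet0 hforms)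
  subst hs
  refine ⟨rfl, ?_⟩
  rw [hends, mul_comm] at corner
  have hcorner := mul_right_cancel₀ hend0 corner
  have : s1 ^ 2 * t1 = s1 ^ 2 * t2 := by linarith
  exact mul_left_cancel₀ (pow_ne_zero 2 hs1.ne') this
end

section
/- Let H be a matrix in Γ₂ and let s1, t1, s2, t2 be rational numbers with s1 > 0, t1 ≥ 0, s2 > 0, t2 ≥ 0, and with t1 and t2 not both equal to zero. Then H·(s1·N1 + t1·N2) ≠ (s2·N1 + t2·N3)·H. (This is the statement that the Ad(Γ₂)-orbit of the nilpotent cone σ12 has no non-trivial interior intersection with the nilpotent cone σ13.) -/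
open Matrix

/-- If the cube-type relation `2s₁³ + 3s₁²t = 2s₂³` holds and `s₁` is a positive integral multiple of
`s₂`, then `t = 0` and `s₁ = s₂`. -/
lemma eq_zero_and_eq_of_cube_relation {s1 s2 t : ℚ} {p : ℤ} (hs1 : 0 < s1) (hs2 : 0 < s2)
    (ht : 0 ≤ t) (hp : s1 = s2 * p) (hcube : 2 * s1 ^ 3 + 3 * s1 ^ 2 * t = 2 * s2 ^ 3) :
    t = 0 ∧ s1 = s2 := by
  have hp0 : (0 : ℚ) < p := by
    by_contra! h
    nlinarith
  have hp1 : (1 : ℚ) ≤ p := by exact_mod_cast hp0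
  have hle : s2 ≤ s1 := by nlinarith
  have hcubes : s2 ^ 3 ≤ s1 ^ 3 := by gcongr
  have hst : 0 ≤ s1 ^ 2 * t := by positivity
  have ht0 : t = 0 := by
    have h : s1 ^ 2 * t = 0 := by linarith
    exact (mul_eq_zero.mp h).resolve_left (by positivity)
  refine ⟨ht0, ?_⟩
  have h : s1 ^ 3 = s2 ^ 3 := by linarith
  exact (pow_left_inj₀ hs1.le hs2.le (by norm_num)).mp h

/-- The `Ad(Γ₂)`-orbit of the nilpotent cone `σ₁₂` has no non-trivial interior
intersection with the nilpotent cone `σ₁₃`. -/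
theorem stmt13 (H : Matrix (Fin 6) (Fin 6) ℤ) (hH : GammaN 2 H)
    (s1 t1 s2 t2 : ℚ) (hs1 : 0 < s1) (ht1 : 0 ≤ t1) (hs2 : 0 < s2) (ht2 : 0 ≤ t2)
    (hne : ¬ (t1 = 0 ∧ t2 = 0)) :
    (H.map (Int.cast : ℤ → ℚ)) * (s1 • N1 + t1 • N2)
      ≠ (s2 • N1 + t2 • N3) * (H.map (Int.cast : ℤ → ℚ)) := by
  intro heq
  obtain ⟨hsymp, hcong⟩ := hH
  have E (i j : Fin 6) := congrFun (congrFun heq i) j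
  have S (i j : Fin 6) := congrFun (congrFun hsymp i) j
  simp only [Matrix.mul_apply, Fin.sum_univ_six, Matrix.map_apply, Matrix.add_apply,
    Matrix.smul_apply, smul_eq_mul] at E
  simp only [Matrix.mul_apply, Fin.sum_univ_six, Matrix.map_apply, Matrix.transpose_apply] at S
  obtain ⟨k, hk⟩ : (2 : ℤ) ∣ H 2 1 := by simpa using hcong 2 1
  have e40 := E 4 0
  have e10 := E 1 0
  have e20 := E 2 0
  have e00 := E 0 0
  have e41 := E 4 1
  have e42 := E 4 2
  have e55 := E 5 5
  have e54 := E 5 4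
  have e11 := E 1 1
  have e12 := E 1 2
  have e21 := E 2 1
  have e45 := E 4 5
  have e33 := E 3 3
  have e01 := E 0 1
  have e02 := E 0 2
  have e43 := E 4 3
  have e53 := E 5 3
  have e14 := E 1 4
  have e15 := E 1 5
  have e24 := E 2 4
  have e25 := E 2 5
  have w03 := S 0 3
  have w25 := S 2 5
  clear E S
  simp [N1, N2, N3] at e40 e10 e20 e00 e41 e42 e55 e54 e11 e12 e21 e45 e33 e01 e02 e43 e53
  simp [N1, N2, N3] at e14 e15 e24 e25
  simp [Q6] at w03 w25
  have h30 : H 3 0 = 0 := e40.resolve_left hs2.ne'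
  have h50' : (H 5 0 : ℚ) = -2 * H 4 0 := mul_left_cancel₀ hs2.ne' (by linarith)
  -- The entries of `H` below the weight filtration vanish.
  have h40 : H 4 0 = 0 := by
    have h : (4 * s2 + 8 * t2) * H 4 0 = 0 := by
      rw [h30, h50'] at e20
      push_cast at e20
      linarith
    exact_mod_cast (mul_eq_zero.mp h).resolve_left (by positivity)
  have h50 : H 5 0 = 0 := by
    rw [h40] at h50'
    exact_mod_cast (by simpa using h50' : (H 5 0 : ℚ) = 0)
  have h10 : H 1 0 = 0 := by simpa [h30, h50, hs2.ne'] using e00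
  have h31 : H 3 1 = 0 := by simpa [h40, hs2.ne'] using e41
  have h32 : H 3 2 = 0 := by simpa [h40, hs2.ne'] using e42
  have h51 : H 5 1 = 0 := by simpa [h50, hs1.ne'] using e55
  have h52 : H 5 2 = 0 := by simpa [h50, h51, hs1.ne'] using e54
  have h41 : H 4 1 = 0 := by simpa [h10, h51, hs2.ne'] using e11
  have h42 : H 4 2 = 0 := by simpa [h10, h52, hs2.ne'] using e12
  have h20 : H 2 0 = 0 := by simpa [h31, h41, h51, hs1.ne'] using e21
  have h35 : H 3 5 = 0 := by simpa [h40, h41, hs2.ne'] using e45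
  have h34 : H 3 4 = 0 := by simpa [h30, h31, h32, h35, hs1.ne'] using e33
  simp only [h30, h40, h50, h10, h31, h32, h51, h52, h41, h42, h20, h35, h34, Int.cast_zero]
    at e01 e02 e43 e53 e14 e15 e24 e25 w03 w25
  have hunit : H 0 0 * H 3 3 = 1 := by
    have h : (H 0 0 : ℚ) * H 3 3 = 1 := by linarith
    exact_mod_cast h
  have h33 : H 3 3 = H 0 0 := by
    rcases Int.mul_eq_one_iff_eq_one_or_neg_one.mp hunit with h | h <;> rw [h.1, h.2]
  have hsq : (H 0 0 : ℚ) * H 0 0 = 1 := by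
    rw [h33] at hunit
    exact_mod_cast hunit
  rw [h33] at e43
  have hp : s1 = s2 * (H 0 0 * H 1 1 : ℤ) := by
    push_cast
    linear_combination (H 0 0 : ℚ) * e01 - s1 * hsq
  have hcube : 2 * s1 ^ 3 + 3 * s1 ^ 2 * t1 = 2 * s2 ^ 3 := by
    linear_combination
      (-1 / 4 * H 0 0 * s2) * (s1 * e14 + t1 * e15 + 8 * s2 * e43 + 4 * s2 * e53)
        + H 0 0 * (2 * s1 ^ 2 + 2 * s1 * t1) * e01 + H 0 0 * s1 ^ 2 * e02
        - (2 * s1 ^ 3 + 3 * s1 ^ 2 * t1 - 2 * s2 ^ 3) * hsq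
  obtain ⟨rfl, rfl⟩ := eq_zero_and_eq_of_cube_relation hs1 hs2 ht1 hp hcube
  have h11 : H 1 1 = H 0 0 := by
    have h : (H 1 1 : ℚ) = H 0 0 := mul_left_cancel₀ hs1.ne' (by linarith)
    exact_mod_cast h
  have h44 : H 4 4 = H 0 0 := by
    have h : (H 4 4 : ℚ) = H 0 0 := mul_left_cancel₀ hs1.ne' (by linarith)
    exact_mod_cast h
  have h54 : H 5 4 = 0 := by simpa [hs1.ne'] using e53
  have h12 : H 1 2 = 0 := by simpa [hs1.ne'] using e02
  rw [h54, h44] at e24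
  rw [h12] at w25
  have hunit' : H 2 2 * H 5 5 = 1 := by
    have h : (H 2 2 : ℚ) * H 5 5 = 1 := by simpa using w25
    exact_mod_cast h
  have h2122 : 2 * H 2 1 + H 2 2 = H 0 0 := by
    have h : 2 * (H 2 1 : ℚ) + H 2 2 = H 0 0 :=
      mul_left_cancel₀ hs1.ne' (by push_cast at e24; linarith)
    exact_mod_cast h
  have h4555 : 2 * H 4 5 + H 5 5 = H 0 0 := by
    rw [h11] at e15
    have h : 2 * (H 4 5 : ℚ) + H 5 5 = H 0 0 :=
      mul_left_cancel₀ hs1.ne' (by linarith)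
    exact_mod_cast h
  obtain ⟨h21, h45, h55⟩ : H 2 1 = 0 ∧ H 4 5 = 0 ∧ H 5 5 ≠ 0 := by
    rcases Int.mul_eq_one_iff_eq_one_or_neg_one.mp hunit with h | h <;>
    rcases Int.mul_eq_one_iff_eq_one_or_neg_one.mp hunit' with h' | h' <;> omega
  exact hne ⟨rfl, by simpa [h21, h45, h55] using e25⟩
end

section
/- Let H be a matrix in Sp(6,Z) and let s1, t1, s2, t2 be rational numbers with s1 > 0, t1 > 0, s2 > 0 and t2 ≥ 0. If H·(s1·N1 + t1·N3) = (s2·N1 + t2·N3)·H, then s1 = s2 and t1 = t2. (This is the statement that the Ad(Sp(6,Z))-orbit of the nilpotent cone σ13 has no non-trivial interior intersection with σ13.) -/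
open Matrix

/-- The rows of the product of a matrix `A` and an element of the cone `σ₁₃`. -/
theorem mul_cone_apply (A : Matrix (Fin 6) (Fin 6) ℚ) (s t : ℚ) (i : Fin 6) :
    (A * (s • N1 + t • N3)) i =
      ![0, s * A i 0, 0, s * (14 / 3 * A i 0 - 2 * A i 2 - A i 4), s * (-8 * A i 1 - 4 * A i 2),
        s * (-2 * A i 0 - 4 * A i 1) + 4 * t * A i 2] := by
  ext j
  fin_cases j <;> simp [N1, N3, Matrix.mul_apply, Fin.sum_univ_six] <;> ring

/-- The columns of the product of an element of the cone `σ₁₃` and a matrix `A`. -/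
theorem cone_mul_apply (A : Matrix (Fin 6) (Fin 6) ℚ) (s t : ℚ) (j : Fin 6) :
    (fun i => ((s • N1 + t • N3) * A) i j) =
      ![s * (A 1 j + 14 / 3 * A 3 j - 2 * A 5 j), s * (-8 * A 4 j - 4 * A 5 j),
        s * (-2 * A 3 j - 4 * A 4 j) + 4 * t * A 5 j, 0, -(s * A 3 j), 0] := by
  ext i
  fin_cases i <;> simp [N1, N3, Matrix.mul_apply, Fin.sum_univ_six] <;> ring

/-- A row whose product with an element `s • N1 + t • N3` of the open cone vanishes is supported on
the coordinates `3` and `5`. -/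
theorem row_eq_zero {s t : ℚ} (hs : 0 < s) (ht : 0 < t) {a : Fin 6 → ℚ} (h1 : s * a 0 = 0)
    (h3 : s * (14 / 3 * a 0 - 2 * a 2 - a 4) = 0) (h4 : s * (-8 * a 1 - 4 * a 2) = 0)
    (h5 : s * (-2 * a 0 - 4 * a 1) + 4 * t * a 2 = 0) :
    a 0 = 0 ∧ a 1 = 0 ∧ a 2 = 0 ∧ a 4 = 0 := by
  have hk : 0 < 2 * s + 4 * t := by positivity
  have z2 : a 2 = 0 := mul_left_cancel₀ hk.ne' (by linear_combination h5 - h4 / 2 + 2 * h1)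
  refine ⟨mul_left_cancel₀ hs.ne' (by linear_combination h1),
    mul_left_cancel₀ hs.ne' (by linear_combination -h4 / 8 - s / 2 * z2), z2,
    mul_left_cancel₀ hs.ne' (by linear_combination -h3 + 14 / 3 * h1 - 2 * s * z2)⟩

/-- The `Ad(Sp(6,ℤ))`-orbit of the nilpotent cone `σ₁₃` has no non-trivial interior
intersection with `σ₁₃`. -/
theorem stmt14 (H : Matrix (Fin 6) (Fin 6) ℤ) (hH : Sp6Z H)
    (s1 t1 s2 t2 : ℚ) (hs1 : 0 < s1) (ht1 : 0 < t1) (hs2 : 0 < s2) (ht2 : 0 ≤ t2)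
    (h : (H.map (Int.cast : ℤ → ℚ)) * (s1 • N1 + t1 • N3)
        = (s2 • N1 + t2 • N3) * (H.map (Int.cast : ℤ → ℚ))) :
    s1 = s2 ∧ t1 = t2 := by
  set A : Matrix (Fin 6) (Fin 6) ℚ := H.map (Int.cast : ℤ → ℚ) with hA
  have entry (i j : Fin 6) := (congrFun (mul_cone_apply A s1 t1 i) j).symm.trans
    ((congrFun (congrFun h i) j).trans (congrFun (cone_mul_apply A s2 t2 j) i))
  obtain ⟨z30, z31, z32, z34⟩ := row_eq_zero hs1 ht1
    (a := A 3) (entry 3 1) (entry 3 3) (entry 3 4) (entry 3 5)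
  obtain ⟨z50, z51, z52, z54⟩ := row_eq_zero hs1 ht1
    (a := A 5) (entry 5 1) (entry 5 3) (entry 5 4) (entry 5 5)
  have e41 : s1 * A 4 0 =
      -(s2 * A 3 1) := entry 4 1
  have e43 : s1 * (14 / 3 * A 4 0 - 2 * A 4 2 - A 4 4) =
      -(s2 * A 3 3) := entry 4 3
  have e44 : s1 * (-8 * A 4 1 - 4 * A 4 2) =
      -(s2 * A 3 4) := entry 4 4
  have e45 : s1 * (-2 * A 4 0 - 4 * A 4 1) + 4 * t1 * A 4 2 =
      -(s2 * A 3 5) := entry 4 5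
  have e12 : 0 =
      s2 * (-8 * A 4 2 - 4 * A 5 2) := entry 1 2
  have e11 : s1 * A 1 0 =
      s2 * (-8 * A 4 1 - 4 * A 5 1) := entry 1 1
  have e21 : s1 * A 2 0 =
      s2 * (-2 * A 3 1 - 4 * A 4 1) + 4 * t2 * A 5 1 := entry 2 1
  have e02 : 0 =
      s2 * (A 1 2 + 14 / 3 * A 3 2 - 2 * A 5 2) := entry 0 2
  have e01 : s1 * A 0 0 =
      s2 * (A 1 1 + 14 / 3 * A 3 1 - 2 * A 5 1) := entry 0 1
  have e14 : s1 * (-8 * A 1 1 - 4 * A 1 2) =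
      s2 * (-8 * A 4 4 - 4 * A 5 4) := entry 1 4
  have e15 : s1 * (-2 * A 1 0 - 4 * A 1 1) + 4 * t1 * A 1 2 =
      s2 * (-8 * A 4 5 - 4 * A 5 5) := entry 1 5
  have e24 : s1 * (-8 * A 2 1 - 4 * A 2 2) =
      s2 * (-2 * A 3 4 - 4 * A 4 4) + 4 * t2 * A 5 4 := entry 2 4
  have e25 : s1 * (-2 * A 2 0 - 4 * A 2 1) + 4 * t1 * A 2 2 =
      s2 * (-2 * A 3 5 - 4 * A 4 5) + 4 * t2 * A 5 5 := entry 2 5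
  have z40 : A 4 0 = 0 :=
    mul_left_cancel₀ hs1.ne' (by linear_combination e41 - s2 * z31)
  have z42 : A 4 2 = 0 :=
    mul_left_cancel₀ hs2.ne' (by linear_combination e12 / 8 - s2 / 2 * z52)
  have z41 : A 4 1 = 0 :=
    mul_left_cancel₀ hs1.ne' (by linear_combination -e44 / 8 - s1 / 2 * z42 + s2 / 8 * z34)
  have z10 : A 1 0 = 0 :=
    mul_left_cancel₀ hs1.ne' (by linear_combination e11 - 8 * s2 * z41 - 4 * s2 * z51)
  have z20 : A 2 0 = 0 :=
    mul_left_cancel₀ hs1.ne' (by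
      linear_combination e21 - 2 * s2 * z31 - 4 * s2 * z41 + 4 * t2 * z51)
  have z12 : A 1 2 = 0 :=
    mul_left_cancel₀ hs2.ne' (by linear_combination -e02 - 14 / 3 * s2 * z32 + 2 * s2 * z52)
  have z35 : A 3 5 = 0 :=
    mul_left_cancel₀ hs2.ne' (by
      linear_combination e45 + 2 * s1 * z40 + 4 * s1 * z41 - 4 * t1 * z42)
  have q03 := congrFun (congrFun hH 0) 3
  have q25 := congrFun (congrFun hH 2) 5
  simp only [z10, z20, z30, z40, z50, z12, z32, z35, z42, z52, ← hA, Q6, Matrix.mul_apply,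
    Matrix.transpose_apply, Fin.sum_univ_six] at q03 q25
  have u0 : A 0 0 * A 3 3 = 1 := by simpa using q03
  have u2 : A 2 2 * A 5 5 = 1 := by simpa using q25
  have unit_eq {a b : ℤ} (hab : (a : ℚ) * b = 1) : (a : ℚ) = b := by
    have hab' : a * b = 1 := by exact_mod_cast hab
    exact_mod_cast Int.eq_of_mul_eq_one hab'
  have d0 : A 0 0 = A 3 3 := unit_eq u0
  have d2 : A 2 2 = A 5 5 := unit_eq u2
  have n0 : A 3 3 ≠ 0 := right_ne_zero_of_mul_eq_one u0
  have n2 : A 5 5 ≠ 0 := right_ne_zero_of_mul_eq_one u2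
  simp only [z10, z20, z31, z34, z35, z40, z42, z51, z54, z12, d0, d2,
    mul_zero, add_zero, zero_sub, sub_zero] at e01 e14 e15 e24 e25 e43
  have f0 : A 3 3 * s1 ^ 3 = A 3 3 * s2 ^ 3 := by
    linear_combination s1 ^ 2 * e01 - s1 * s2 / 8 * e14 - s2 ^ 2 * e43
  have hs : s1 = s2 := (pow_left_inj₀ hs1.le hs2.le three_ne_zero).mp (mul_left_cancel₀ n0 f0)
  subst hs
  refine ⟨rfl, mul_left_cancel₀ n2 ?_⟩
  linear_combination e25 / 4 - e24 / 8 - e15 / 8 + e14 / 16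
end

section
/- The matrices G34, G63, G67 all belong to Sp(6,Z), and each conjugates the corresponding type-I_2 nilpotent cone onto the standard cone spanned by E14 and E25: for all rational numbers s > 0 and t > 0 there exist rational numbers s' > 0 and t' > 0 such that G34·(s·N3 + t·N4)·G34⁻¹ = s'·E14 + t'·E25, and likewise there exist positive rationals with G63·(s·N6 + t·N3)·G63⁻¹ = s'·E14 + t'·E25 and G67·(s·N6 + t·N7)·G67⁻¹ = s'·E14 + t'·E25. -/
open Matrix

/-- An element of `Sp(6,ℤ)` is invertible over `ℚ`. -/
theorem Sp6Z.isUnit_det {H : Matrix (Fin 6) (Fin 6) ℤ} (hH : Sp6Z H) :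
    IsUnit (H.map (Int.cast : ℤ → ℚ)).det := by
  have hQ : Q6 * Q6 = -1 := by decide +kernel
  refine isUnit_det_of_left_inverse (B := -(Q6 * (H.map (Int.cast : ℤ → ℚ))ᵀ * Q6)) ?_
  rw [Matrix.neg_mul, Matrix.mul_assoc, Matrix.mul_assoc, ← Matrix.mul_assoc _ Q6,
    show (H.map (Int.cast : ℤ → ℚ))ᵀ * Q6 * H.map (Int.cast : ℤ → ℚ) = Q6 from hH, hQ, neg_neg]

/-- If `H ∈ Sp(6,ℤ)` intertwines `A` with `a • A'` and `B` with `b • B'`, then conjugation by `H`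
sends `s • A + t • B` to `(s * a) • A' + (t * b) • B'`. -/
theorem Sp6Z.conj_smul_add_smul {H : Matrix (Fin 6) (Fin 6) ℤ} (hH : Sp6Z H)
    {A B A' B' : Matrix (Fin 6) (Fin 6) ℚ} {a b : ℚ}
    (hA : H.map (Int.cast : ℤ → ℚ) * A = (a • A') * H.map (Int.cast : ℤ → ℚ))
    (hB : H.map (Int.cast : ℤ → ℚ) * B = (b • B') * H.map (Int.cast : ℤ → ℚ)) (s t : ℚ) :
    H.map (Int.cast : ℤ → ℚ) * (s • A + t • B) * (H.map (Int.cast : ℤ → ℚ))⁻¹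
      = (s * a) • A' + (t * b) • B' := by
  rw [Matrix.mul_add, Matrix.mul_smul, Matrix.mul_smul, hA, hB, ← Matrix.smul_mul,
    ← Matrix.smul_mul, ← Matrix.add_mul, mul_nonsing_inv_cancel_right _ _ hH.isUnit_det,
    smul_smul, smul_smul]

/-- `G34`, `G63`, `G67` lie in `Sp(6,ℤ)` and conjugate the type-`I₂` nilpotent cones
`σ₃₄`, `σ₆₃`, `σ₆₇` onto the standard cone spanned by `E14` and `E25`. -/
theorem stmt18 :
    Sp6Z G34 ∧ Sp6Z G63 ∧ Sp6Z G67 ∧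
    ∀ s t : ℚ, 0 < s → 0 < t →
      (∃ s' t' : ℚ, 0 < s' ∧ 0 < t' ∧
        (G34.map (Int.cast : ℤ → ℚ)) * (s • N3 + t • N4) * (G34.map (Int.cast : ℤ → ℚ))⁻¹
          = s' • E14 + t' • E25) ∧
      (∃ s' t' : ℚ, 0 < s' ∧ 0 < t' ∧
        (G63.map (Int.cast : ℤ → ℚ)) * (s • N6 + t • N3) * (G63.map (Int.cast : ℤ → ℚ))⁻¹
          = s' • E14 + t' • E25) ∧
      (∃ s' t' : ℚ, 0 < s' ∧ 0 < t' ∧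
        (G67.map (Int.cast : ℤ → ℚ)) * (s • N6 + t • N7) * (G67.map (Int.cast : ℤ → ℚ))⁻¹
          = s' • E14 + t' • E25) := by
  have h34 : Sp6Z G34 := by unfold Sp6Z; decide +kernel
  have h63 : Sp6Z G63 := by unfold Sp6Z; decide +kernel
  have h67 : Sp6Z G67 := by unfold Sp6Z; decide +kernel
  refine ⟨h34, h63, h67, fun s t hs ht => ⟨?_, ?_, ?_⟩⟩
  · refine ⟨t * 1, s * 4, by positivity, by positivity, ?_⟩
    rw [h34.conj_smul_add_smul (A' := E25) (B' := E14) (a := 4) (b := 1)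
      (by decide +kernel) (by decide +kernel), add_comm]
  · refine ⟨t * 4, s * 2, by positivity, by positivity, ?_⟩
    rw [h63.conj_smul_add_smul (A' := E25) (B' := E14) (a := 2) (b := 4)
      (by decide +kernel) (by decide +kernel), add_comm]
  · refine ⟨s * 2, t * 1, by positivity, by positivity, ?_⟩
    exact h67.conj_smul_add_smul (by decide +kernel) (by decide +kernel) s t
end
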